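/- (Margulis's Opposite Sign Lemma.) For i = 1, 2, let γᵢ : x ↦ Gᵢ x + uᵢ be affine transformations of ℝ³ with Gᵢ ∈ SO(2,1), where for each i the fixed subspace ker(Gᵢ − I) is spanned by a vector vᵢ⁰ with ⟨vᵢ⁰, vᵢ⁰⟩ = 1, normalized so that det[v, Gᵢ² v, vᵢ⁰] > 0 for every timelike v (columns of a 3×3 matrix). If ⟨u₁, v₁⁰⟩ > 0 > ⟨u₂, v₂⁰⟩, then the group generated by γ₁ and γ₂ does not act properly discontinuously on ℝ³: there exists a compact set K ⊂ ℝ³ such that infinitely many elements γ of the group satisfy γ(K) ∩ K ≠ ∅. -/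

import Mathlib

/-- The Minkowski bilinear form on ℝ³: ⟨x,y⟩ = x₁y₁ + x₂y₂ − x₃y₃. -/
def minkowski (x y : Fin 3 → ℝ) : ℝ := x 0 * y 0 + x 1 * y 1 - x 2 * y 2

/-- The Lorentzian cross product, dual to the determinant under `minkowski`. -/
def minkowskiCross (x y : Fin 3 → ℝ) : Fin 3 → ℝ :=
  ![x 1 * y 2 - x 2 * y 1, x 2 * y 0 - x 0 * y 2, -(x 0 * y 1 - x 1 * y 0)]

lemma minkowski_comm (x y : Fin 3 → ℝ) : minkowski x y = minkowski y x := by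
  simp only [minkowski]; ring

lemma minkowski_add_left (x y z : Fin 3 → ℝ) :
    minkowski (x + y) z = minkowski x z + minkowski y z := by
  simp only [minkowski, Pi.add_apply]; ring

lemma minkowski_sub_left (x y z : Fin 3 → ℝ) :
    minkowski (x - y) z = minkowski x z - minkowski y z := by
  simp only [minkowski, Pi.sub_apply]; ring

lemma minkowski_smul_left (c : ℝ) (x z : Fin 3 → ℝ) :
    minkowski (c • x) z = c * minkowski x z := by
  simp only [minkowski, Pi.smul_apply, smul_eq_mul]; ring

lemma minkowski_neg_left (x z : Fin 3 → ℝ) : minkowski (-x) z = -minkowski x z := by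
  simp only [minkowski, Pi.neg_apply]; ring

lemma minkowski_add_right (x y z : Fin 3 → ℝ) :
    minkowski z (x + y) = minkowski z x + minkowski z y := by
  simp only [minkowski, Pi.add_apply]; ring

lemma minkowski_smul_right (c : ℝ) (x z : Fin 3 → ℝ) :
    minkowski z (c • x) = c * minkowski z x := by
  simp only [minkowski, Pi.smul_apply, smul_eq_mul]; ring

lemma minkowski_neg_right (x z : Fin 3 → ℝ) : minkowski z (-x) = -minkowski z x := by
  simp only [minkowski, Pi.neg_apply]; ring

lemma minkowskiCross_neg_right (x y : Fin 3 → ℝ) :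
    minkowskiCross x (-y) = -minkowskiCross x y := by
  ext i; fin_cases i <;> simp [minkowskiCross] <;> ring

lemma minkowskiCross_self_left (x y : Fin 3 → ℝ) : minkowski (minkowskiCross x y) x = 0 := by
  simp [minkowski, minkowskiCross]; ring

lemma minkowskiCross_self_right (x y : Fin 3 → ℝ) : minkowski (minkowskiCross x y) y = 0 := by
  simp [minkowski, minkowskiCross]; ring

/-- `minkowskiCross x y` paired with `z` is antisymmetric in `y` and `z`. -/
lemma minkowski_minkowskiCross_swap (x y z : Fin 3 → ℝ) :
    minkowski (minkowskiCross x y) z = -minkowski (minkowskiCross x z) y := by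
  simp [minkowski, minkowskiCross]; ring

/-- `minkowskiCross x y` paired with `z` is invariant under cyclic permutations. -/
lemma minkowski_minkowskiCross_cyclic (x y z : Fin 3 → ℝ) :
    minkowski (minkowskiCross x y) z = minkowski (minkowskiCross y z) x := by
  simp [minkowski, minkowskiCross]; ring

/-- A basis of Minkowski space consisting of a spacelike unit vector `v` and two null vectors
`e`, `f` orthogonal to it, oriented so that `det[e, f, v] = -1`. -/
structure IsNullFrame (e f v : Fin 3 → ℝ) : Prop where
  ee : minkowski e e = 0
  ff : minkowski f f = 0
  ef : minkowski e f = -1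
  ev : minkowski e v = 0
  fv : minkowski f v = 0
  vv : minkowski v v = 1
  cross_e : minkowskiCross e v = -e
  cross_f : minkowskiCross f v = f
  expand : ∀ x, x = minkowski x v • v - minkowski x f • e - minkowski x e • f

lemma IsNullFrame.symm {e f v : Fin 3 → ℝ} (h : IsNullFrame e f v) : IsNullFrame f e (-v) where
  ee := h.ff
  ff := h.ee
  ef := by rw [minkowski_comm, h.ef]
  ev := by rw [minkowski_neg_right, h.fv, neg_zero]
  fv := by rw [minkowski_neg_right, h.ev, neg_zero]
  vv := by rw [minkowski_neg_right, minkowski_neg_left, h.vv, neg_neg]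
  cross_e := by rw [minkowskiCross_neg_right, h.cross_f]
  cross_f := by rw [minkowskiCross_neg_right, h.cross_e, neg_neg]
  expand x := by
    rw [minkowski_neg_right]
    nth_rw 1 [h.expand x]
    module

/-- The null vectors of a null frame are not both orthogonal to a null vector of another one. -/
lemma IsNullFrame.minkowski_ne_zero {e f v n m w : Fin 3 → ℝ} (h : IsNullFrame e f v)
    (h' : IsNullFrame n m w) (he : minkowski e n = 0) : minkowski f n ≠ 0 := by
  intro hf
  have hn := h.expand n
  rw [minkowski_comm n e, minkowski_comm n f, he, hf] at hn
  have hn' : n = minkowski n v • v := by simpa using hn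
  have h1 := h'.ee
  have h2 := h'.ef
  rw [hn', minkowski_smul_left, minkowski_smul_right, h.vv] at h1
  have h3 : minkowski n v = 0 := by simpa using h1
  rw [hn', h3, minkowski_smul_left] at h2
  norm_num at h2

/-- Every spacelike unit vector is part of a null frame. -/
lemma exists_isNullFrame (v : Fin 3 → ℝ) (hv : minkowski v v = 1) :
    ∃ e f, IsNullFrame e f v := by
  obtain ⟨a, ha⟩ : ∃ a, a = v 0 := ⟨_, rfl⟩
  obtain ⟨b, hb⟩ : ∃ b, b = v 1 := ⟨_, rfl⟩
  obtain ⟨c, hc⟩ : ∃ c, c = v 2 := ⟨_, rfl⟩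
  have hva : v = ![a, b, c] := by ext i; fin_cases i <;> simp [ha, hb, hc]
  subst hva
  clear ha hb hc
  have h : a * a + b * b - c * c = 1 := by simpa [minkowski] using hv
  have hr : (1 + c * c : ℝ) ≠ 0 := by nlinarith [mul_self_nonneg c]
  refine ⟨![-b - a * c, a - b * c, -(1 + c * c)],
    (-(2 * (1 + c * c))⁻¹) • ![-b + a * c, a + b * c, 1 + c * c], ?_⟩
  constructor
  · simp [minkowski]
    linear_combination (1 + c * c) * h
  · simp [minkowski]
    field_simp
    linear_combination (1 + c * c) * h
  · simp [minkowski]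
    field_simp
    linear_combination (c * c - 1) * h
  · simp [minkowski]
    linear_combination (-c) * h
  · simp [minkowski]
    field_simp
    linear_combination (-c) * h
  · exact hv
  · ext i
    fin_cases i <;> simp [minkowskiCross]
    · ring
    · ring
    · linear_combination h
  · ext i
    fin_cases i <;> simp [minkowskiCross] <;> field_simp
    · ring
    · ring
    · linear_combination -h
  · intro x
    ext i
    fin_cases i <;> simp [minkowski] <;> field_simp
    · linear_combination (-2 * x 0) * h
    · linear_combination (-2 * x 1) * h
    · ring

/-- The square of an isometry fixing the spacelike vector of a null frame scales its null
vectors by reciprocal positive factors. -/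
lemma IsNullFrame.exists_sq_eigenvalue {e f v : Fin 3 → ℝ} (h : IsNullFrame e f v)
    (G : (Fin 3 → ℝ) ≃ₗ[ℝ] (Fin 3 → ℝ))
    (hO : ∀ x y : Fin 3 → ℝ, minkowski (G x) (G y) = minkowski x y) (hG : G v = v) :
    ∃ μ : ℝ, 0 < μ ∧ G (G e) = μ • e ∧ G (G f) = μ⁻¹ • f := by
  have hperp : ∀ x, minkowski x v = 0 → minkowski x x = 0 →
      (∃ a : ℝ, G x = a • e) ∨ ∃ a : ℝ, G x = a • f := by
    intro x hx hxx
    have h1 : minkowski (G x) v = 0 := by rw [← hx, ← hO x v, hG]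
    have h2 := h.expand (G x)
    have h3 : minkowski (G x) (G x) = 0 := by rw [hO, hxx]
    have h4 : minkowski (G x) f * minkowski (G x) e = 0 := by
      have h5 : minkowski (minkowski (G x) v • v - minkowski (G x) f • e - minkowski (G x) e • f)
          (G x) = 0 := by rw [← h2]; exact h3
      rw [minkowski_sub_left, minkowski_sub_left, minkowski_smul_left, minkowski_smul_left,
        minkowski_smul_left, minkowski_comm v, minkowski_comm e, minkowski_comm f, h1] at h5
      linarith
    rcases mul_eq_zero.1 h4 with h5 | h5
    · right
      exact ⟨-minkowski (G x) e, by rw [h1, h5] at h2; exact h2.trans (by module)⟩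
    · left
      exact ⟨-minkowski (G x) f, by rw [h1, h5] at h2; exact h2.trans (by module)⟩
  have hef : minkowski (G e) (G f) = -1 := by rw [hO, h.ef]
  rcases hperp e h.ev h.ee with ⟨a, ha⟩ | ⟨a, ha⟩ <;>
    rcases hperp f h.fv h.ff with ⟨b, hb⟩ | ⟨b, hb⟩ <;>
    rw [ha, hb, minkowski_smul_left, minkowski_smul_right] at hef
  · simp [h.ee] at hef
  · have hab : a * b = 1 := by rw [h.ef] at hef; linarith
    have ha0 : a ≠ 0 := left_ne_zero_of_mul_eq_one hab
    have hb' : b = a⁻¹ := eq_inv_of_mul_eq_one_right hab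
    refine ⟨a * a, mul_self_pos.2 ha0, ?_, ?_⟩
    · rw [ha, map_smul, ha, smul_smul]
    · rw [hb, map_smul, hb, smul_smul, hb', mul_inv]
  · have hab : a * b = 1 := by rw [minkowski_comm, h.ef] at hef; linarith
    refine ⟨1, one_pos, ?_, ?_⟩
    · rw [ha, map_smul, hb, smul_smul, hab]
    · rw [hb, map_smul, ha, smul_smul, mul_comm, hab, inv_one]
  · simp [h.ff] at hef

/-- The affine transformation `β` translates by `α • v` along the line through `c` directed by
`v`, expands `e` by the factor `μ > 1` and contracts `f` by `μ⁻¹`. -/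
structure IsHyperbolicAffine (β : (Fin 3 → ℝ) ≃ᵃ[ℝ] (Fin 3 → ℝ)) (e f v c : Fin 3 → ℝ)
    (μ α : ℝ) : Prop where
  frame : IsNullFrame e f v
  one_lt : 1 < μ
  apply_eq : ∀ s p q : ℝ, β (c + s • v + p • e + q • f) =
    c + (s + α) • v + (μ * p) • e + (μ⁻¹ * q) • f

lemma IsHyperbolicAffine.inv {β : (Fin 3 → ℝ) ≃ᵃ[ℝ] (Fin 3 → ℝ)} {e f v c : Fin 3 → ℝ}
    {μ α : ℝ} (h : IsHyperbolicAffine β e f v c μ α) :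
    IsHyperbolicAffine β⁻¹ f e (-v) c μ α where
  frame := h.frame.symm
  one_lt := h.one_lt
  apply_eq s p q := by
    have hμ : μ ≠ 0 := (one_pos.trans h.one_lt).ne'
    have h1 := h.apply_eq (-(s + α)) (μ⁻¹ * q) (μ * p)
    rw [mul_inv_cancel_left₀ hμ, inv_mul_cancel_left₀ hμ] at h1
    rw [AffineEquiv.inv_def, AffineEquiv.symm_apply_eq]
    convert h1.symm using 1
    · module
    · congr 1
      module

lemma IsHyperbolicAffine.pow_apply {β : (Fin 3 → ℝ) ≃ᵃ[ℝ] (Fin 3 → ℝ)} {e f v c : Fin 3 → ℝ}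
    {μ α : ℝ} (h : IsHyperbolicAffine β e f v c μ α) (n : ℕ) (s p q : ℝ) :
    (β ^ n) (c + s • v + p • e + q • f) =
      c + (s + n * α) • v + (μ ^ n * p) • e + (μ⁻¹ ^ n * q) • f := by
  induction n with
  | zero => simp
  | succ n ih =>
    rw [pow_succ', AffineEquiv.mul_def, AffineEquiv.trans_apply, ih, h.apply_eq, ← mul_assoc,
      ← pow_succ', ← mul_assoc, ← pow_succ']
    push_cast
    module

lemma IsHyperbolicAffine.minkowski_pow_apply {β : (Fin 3 → ℝ) ≃ᵃ[ℝ] (Fin 3 → ℝ)}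
    {e f v c : Fin 3 → ℝ} {μ α : ℝ} (h : IsHyperbolicAffine β e f v c μ α) (n : ℕ)
    (x : Fin 3 → ℝ) :
    minkowski ((β ^ n) x - c) e = μ⁻¹ ^ n * minkowski (x - c) e := by
  have hx : x = c + minkowski (x - c) v • v + (-minkowski (x - c) f) • e +
      (-minkowski (x - c) e) • f := by
    have := h.frame.expand (x - c)
    rw [sub_eq_iff_eq_add] at this
    nth_rw 1 [this]
    module
  have hpow := h.pow_apply n (minkowski (x - c) v) (-minkowski (x - c) f) (-minkowski (x - c) e)
  rw [← hx] at hpow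
  rw [hpow, minkowski_sub_left, minkowski_add_left, minkowski_add_left, minkowski_add_left]
  simp only [minkowski_smul_left]
  rw [h.frame.ee, minkowski_comm v, h.frame.ev, minkowski_comm f, h.frame.ef]
  ring

/-- The square of an affine transformation whose linear part has neutral vector `v` is
hyperbolic, with twice the Margulis invariant. -/
lemma exists_isHyperbolicAffine_sq (G : (Fin 3 → ℝ) ≃ₗ[ℝ] (Fin 3 → ℝ))
    (hO : ∀ x y : Fin 3 → ℝ, minkowski (G x) (G y) = minkowski x y)
    (v : Fin 3 → ℝ) (hG : G v = v) (hunit : minkowski v v = 1)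
    (hor : ∀ x : Fin 3 → ℝ, minkowski x x < 0 →
      0 < Matrix.det (Matrix.transpose (Matrix.of ![x, G (G x), v])))
    (u : Fin 3 → ℝ) (γ : (Fin 3 → ℝ) ≃ᵃ[ℝ] (Fin 3 → ℝ)) (hγ : ∀ x, γ x = G x + u) :
    ∃ e f c μ, IsHyperbolicAffine (γ ^ 2) e f v c μ (2 * minkowski u v) := by
  obtain ⟨e, f, h⟩ := exists_isNullFrame v hunit
  obtain ⟨μ, hμ, he, hf⟩ := h.exists_sq_eigenvalue G hO hG
  have hμ1 : 1 < μ := by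
    have h1 := hor (e + f) (by
      rw [minkowski_add_left, minkowski_add_right, minkowski_add_right, h.ee, h.ff,
        minkowski_comm f e, h.ef]
      norm_num)
    have h2 : Matrix.det (Matrix.transpose (Matrix.of ![e + f, G (G (e + f)), v])) =
        (μ⁻¹ - μ) * minkowski (minkowskiCross e f) v := by
      rw [map_add, map_add, he, hf, Matrix.det_transpose, Matrix.det_fin_three]
      simp [minkowski, minkowskiCross]
      ring
    rw [h2, minkowski_minkowskiCross_swap, h.cross_e, minkowski_neg_left, h.ef] at h1
    by_contra! h3
    have := one_le_inv_iff₀.2 ⟨hμ, h3⟩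
    linarith
  have hsq : ∀ x, (γ ^ 2) x = G (G x) + (G u + u) := fun x => by
    rw [pow_two, AffineEquiv.mul_def, AffineEquiv.trans_apply, hγ, hγ, map_add, add_assoc]
  obtain ⟨w, hw⟩ : ∃ w, w = G u + u := ⟨_, rfl⟩
  have hwv : minkowski w v = 2 * minkowski u v := by
    have : minkowski (G u) v = minkowski u v := by rw [← hO u v, hG]
    rw [hw, minkowski_add_left, this]
    ring
  have hμ2 : μ - 1 ≠ 0 := by linarith
  refine ⟨e, f, (minkowski w f / (μ - 1)) • e + (-(minkowski w e * μ) / (μ - 1)) • f, μ, h, hμ1, ?_⟩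
  intro s p q
  have hexp := h.expand w
  rw [hwv] at hexp
  rw [hsq, ← hw]
  nth_rw 3 [hexp]
  simp only [map_add, map_smul, he, hf, hG, smul_smul]
  match_scalars <;> field_simp <;> ring

lemma exists_bound_mul_pow {r : ℝ} (hr0 : 0 ≤ r) (hr : r < 1) (A B : ℝ) :
    ∃ M, ∀ n : ℕ, |r ^ n * (A + n * B)| ≤ M := by
  have h1 := (tendsto_pow_atTop_nhds_zero_of_lt_one hr0 hr).mul_const A
  have h2 := (tendsto_self_mul_const_pow_of_lt_one hr0 hr).mul_const B
  obtain ⟨M, hM⟩ := ((h1.add h2).abs).bddAbove_range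
  refine ⟨M, fun n => ?_⟩
  refine le_trans (le_of_eq ?_) (hM ⟨n, rfl⟩)
  simp only
  congr 1
  ring

/-- The compact box of points at bounded position along `v` and `e` from `c`. -/
lemma isCompact_affine_box (c v e : Fin 3 → ℝ) (S P : ℝ) :
    IsCompact ((fun t : ℝ × ℝ => c + t.1 • v + t.2 • e) '' (Set.Icc (-S) S ×ˢ Set.Icc (-P) P)) :=
  (isCompact_Icc.prod isCompact_Icc).image (by fun_prop)

/-- Positive powers of `β₁` are not powers of `β₂` when `e₁` is not parallel to `e₂`. -/
lemma IsHyperbolicAffine.pow_ne_pow {β₁ β₂ : (Fin 3 → ℝ) ≃ᵃ[ℝ] (Fin 3 → ℝ)}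
    {e₁ f₁ v₁ c₁ e₂ f₂ v₂ c₂ : Fin 3 → ℝ} {μ₁ α₁ μ₂ α₂ : ℝ}
    (h₁ : IsHyperbolicAffine β₁ e₁ f₁ v₁ c₁ μ₁ α₁) (h₂ : IsHyperbolicAffine β₂ e₂ f₂ v₂ c₂ μ₂ α₂)
    (hne : minkowski e₁ e₂ ≠ 0) {k l : ℕ} (hk : k ≠ 0) : β₁ ^ k ≠ β₂ ^ l := by
  intro heq
  have key : ∀ p : ℝ, minkowski (c₁ + (k * α₁) • v₁ + (μ₁ ^ k * p) • e₁ - c₂) e₂ =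
      μ₂⁻¹ ^ l * minkowski (c₁ + p • e₁ - c₂) e₂ := by
    intro p
    rw [← h₂.minkowski_pow_apply, ← heq]
    have := h₁.pow_apply k 0 p 0
    simp only [zero_smul, add_zero, mul_zero, zero_add] at this
    rw [this]
  have k0 := key 0
  have k1 := key 1
  simp only [minkowski_sub_left, minkowski_add_left, minkowski_smul_left] at k0 k1
  have : μ₁ ^ k = μ₂⁻¹ ^ l := by
    apply mul_right_cancel₀ hne
    linear_combination k1 - k0
  have h3 := one_lt_pow₀ h₁.one_lt hk
  have h4 : μ₂⁻¹ ^ l ≤ 1 :=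
    pow_le_one₀ (inv_nonneg.2 (one_pos.trans h₂.one_lt).le) (inv_le_one_of_one_le₀ h₂.one_lt.le)
  linarith

/-- If the expanding directions `e₁`, `e₂` of two hyperbolic affine transformations with
Margulis invariants of opposite signs are not parallel, then infinitely many elements
`(β₂ ^ b)⁻¹ * β₁ ^ a` map some compact set to one that meets it: the planes `c₁ + ⟨v₁, e₁⟩` and
`c₂ + ⟨v₂, e₂⟩` meet in a line, which both `β₁ ^ a` and `β₂ ^ b` reach from a bounded region. -/
lemma IsHyperbolicAffine.exists_isCompact_infinite
    {β₁ β₂ : (Fin 3 → ℝ) ≃ᵃ[ℝ] (Fin 3 → ℝ)}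
    {e₁ f₁ v₁ c₁ e₂ f₂ v₂ c₂ : Fin 3 → ℝ} {μ₁ α₁ μ₂ α₂ : ℝ}
    (h₁ : IsHyperbolicAffine β₁ e₁ f₁ v₁ c₁ μ₁ α₁) (h₂ : IsHyperbolicAffine β₂ e₂ f₂ v₂ c₂ μ₂ α₂)
    (hne : minkowski e₁ e₂ ≠ 0) (hα₁ : 0 < α₁) (hα₂ : α₂ < 0)
    (S : Subgroup ((Fin 3 → ℝ) ≃ᵃ[ℝ] (Fin 3 → ℝ))) (hβ₁ : β₁ ∈ S) (hβ₂ : β₂ ∈ S) :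
    ∃ K : Set (Fin 3 → ℝ), IsCompact K ∧
      {γ : (Fin 3 → ℝ) ≃ᵃ[ℝ] (Fin 3 → ℝ) | γ ∈ S ∧ (γ '' K ∩ K).Nonempty}.Infinite := by
  -- a direction common to the two weakly unstable planes
  obtain ⟨w, k₁, k₂, hw₁, hw₂⟩ : ∃ w k₁ k₂, w = v₁ + k₁ • e₁ ∧ w = -v₂ + k₂ • e₂ := by
    obtain ⟨w, hw⟩ : ∃ w, w = (minkowski e₁ e₂)⁻¹ • minkowskiCross e₁ e₂ := ⟨_, rfl⟩
    refine ⟨w, -minkowski w f₁, -minkowski w f₂, ?_, ?_⟩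
    · have h3 : minkowski w e₁ = 0 := by
        rw [hw, minkowski_smul_left, minkowskiCross_self_left, mul_zero]
      have h4 : minkowski w v₁ = 1 := by
        rw [hw, minkowski_smul_left, minkowski_minkowskiCross_swap, h₁.frame.cross_e,
          minkowski_neg_left, neg_neg, inv_mul_cancel₀ hne]
      have h5 := h₁.frame.expand w
      rw [h3, h4] at h5
      nth_rw 1 [h5]
      module
    · have h3 : minkowski w e₂ = 0 := by
        rw [hw, minkowski_smul_left, minkowskiCross_self_right, mul_zero]
      have h4 : minkowski w v₂ = -1 := by
        rw [hw, minkowski_smul_left, minkowski_minkowskiCross_cyclic, h₂.frame.cross_e,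
          minkowski_neg_left, minkowski_comm e₂, mul_neg, inv_mul_cancel₀ hne]
      have h5 := h₂.frame.expand w
      rw [h3, h4] at h5
      nth_rw 1 [h5]
      module
  -- a point common to the two weakly unstable planes
  obtain ⟨y, s, p, ho⟩ : ∃ y s p : ℝ, c₁ + y • e₁ = c₂ + s • v₂ + p • e₂ := by
    obtain ⟨y, hy⟩ : ∃ y, y = -minkowski (c₁ - c₂) e₂ / minkowski e₁ e₂ := ⟨_, rfl⟩
    have h3 : minkowski (c₁ - c₂ + y • e₁) e₂ = 0 := by
      rw [minkowski_add_left, minkowski_smul_left, hy, div_mul_cancel₀ _ hne, add_neg_cancel]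
    have h5 := h₂.frame.expand (c₁ - c₂ + y • e₁)
    rw [h3] at h5
    refine ⟨y, minkowski (c₁ - c₂ + y • e₁) v₂, -minkowski (c₁ - c₂ + y • e₁) f₂, ?_⟩
    calc c₁ + y • e₁ = c₂ + (c₁ - c₂ + y • e₁) := by module
      _ = _ := by nth_rw 1 [h5]; module
  have hμ₁ : 0 < μ₁ := one_pos.trans h₁.one_lt
  have hμ₂ : 0 < μ₂ := one_pos.trans h₂.one_lt
  obtain ⟨b, hb⟩ : ∃ b : ℕ → ℕ, b = fun a : ℕ => ⌊a * α₁ / -α₂⌋₊ := ⟨_, rfl⟩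
  have hα₂' : 0 < -α₂ := neg_pos.2 hα₂
  have hb_le : ∀ a, b a * -α₂ ≤ a * α₁ := fun a => by
    rw [← le_div_iff₀ hα₂', hb]
    exact Nat.floor_le (by positivity)
  have hb_lt : ∀ a, a * α₁ < (b a + 1) * -α₂ := fun a => by
    rw [← div_lt_iff₀ hα₂', hb]
    exact Nat.lt_floor_add_one _
  have hb_mono : Monotone b := fun a a' haa' => by
    rw [hb]
    dsimp only
    gcongr
  obtain ⟨M₁, hM₁⟩ := exists_bound_mul_pow (inv_nonneg.2 hμ₁.le)
    (inv_lt_one_of_one_lt₀ h₁.one_lt) y (α₁ * k₁)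
  obtain ⟨M₂, hM₂⟩ := exists_bound_mul_pow (inv_nonneg.2 hμ₂.le)
    (inv_lt_one_of_one_lt₀ h₂.one_lt) (|p| + -α₂ * |k₂|) (-α₂ * |k₂|)
  obtain ⟨x, hx⟩ : ∃ x : ℕ → Fin 3 → ℝ, ∀ a, x a = c₁ + (0 : ℝ) • v₁ +
      (μ₁⁻¹ ^ a * (y + a * (α₁ * k₁))) • e₁ := ⟨_, fun _ => rfl⟩
  obtain ⟨z, hz⟩ : ∃ z : ℕ → Fin 3 → ℝ, ∀ a, z a = c₂ + (s - a * α₁ - b a * α₂) • v₂ +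
      (μ₂⁻¹ ^ b a * (p + a * α₁ * k₂)) • e₂ := ⟨_, fun _ => rfl⟩
  have hxz : ∀ a, (β₁ ^ a) (x a) = (β₂ ^ b a) (z a) := by
    intro a
    have e1 := h₁.pow_apply a 0 (μ₁⁻¹ ^ a * (y + a * (α₁ * k₁))) 0
    have e2 := h₂.pow_apply (b a) (s - a * α₁ - b a * α₂) (μ₂⁻¹ ^ b a * (p + a * α₁ * k₂)) 0
    rw [zero_smul ℝ f₁, add_zero, ← hx, ← mul_assoc, ← mul_pow, mul_inv_cancel₀ hμ₁.ne', one_pow,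
      one_mul, mul_zero, zero_smul, add_zero] at e1
    rw [zero_smul ℝ f₂, add_zero, ← hz, ← mul_assoc, ← mul_pow, mul_inv_cancel₀ hμ₂.ne', one_pow,
      one_mul, mul_zero, zero_smul, add_zero] at e2
    rw [e1, e2]
    calc _ = (c₁ + y • e₁) + (a * α₁) • (v₁ + k₁ • e₁) := by module
      _ = (c₂ + s • v₂ + p • e₂) + (a * α₁) • (-v₂ + k₂ • e₂) := by rw [ho, ← hw₁, hw₂]
      _ = _ := by module
  refine ⟨_, (isCompact_affine_box c₁ v₁ e₁ 0 M₁).union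
    (isCompact_affine_box c₂ v₂ e₂ (|s| + -α₂) M₂), ?_⟩
  refine Set.infinite_of_injective_forall_mem (f := fun a : ℕ => (β₂ ^ b a)⁻¹ * β₁ ^ a) ?_ ?_
  · refine Function.Injective.of_lt_imp_ne fun a a' haa' heq => ?_
    refine h₁.pow_ne_pow h₂ hne (k := a' - a) (l := b a' - b a) (by omega) ?_
    rw [pow_sub _ haa'.le, pow_sub _ (hb_mono haa'.le)]
    rw [mul_inv_eq_iff_eq_mul, mul_assoc, heq, mul_inv_cancel_left]
  · intro a
    refine ⟨S.mul_mem (S.inv_mem (S.pow_mem hβ₂ _)) (S.pow_mem hβ₁ _), z a,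
      ⟨x a, Or.inl ⟨(0, _), ⟨by simp, abs_le.1 (hM₁ a)⟩, (hx a).symm⟩, ?_⟩,
      Or.inr ⟨(_, _), ⟨abs_le.1 ?_, abs_le.1 ?_⟩, (hz a).symm⟩⟩
    · rw [AffineEquiv.mul_def, AffineEquiv.trans_apply, hxz, AffineEquiv.inv_def,
        AffineEquiv.symm_apply_apply]
    · dsimp only
      have h3 : |a * α₁ + b a * α₂| ≤ -α₂ := by
        rw [abs_le]
        constructor <;> nlinarith [hb_le a, hb_lt a]
      calc |s - a * α₁ - b a * α₂| = |s - (a * α₁ + b a * α₂)| := by rw [sub_sub]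
        _ ≤ |s| + |a * α₁ + b a * α₂| := abs_sub _ _
        _ ≤ _ := by gcongr
    · dsimp only
      refine le_trans ?_ ((le_abs_self _).trans (hM₂ (b a)))
      rw [abs_mul, abs_of_nonneg (by positivity : 0 ≤ μ₂⁻¹ ^ b a)]
      gcongr
      calc |p + a * α₁ * k₂| ≤ |p| + |a * α₁ * k₂| := abs_add_le _ _
        _ = |p| + a * α₁ * |k₂| := by rw [abs_mul, abs_of_nonneg (by positivity : 0 ≤ a * α₁)]
        _ ≤ |p| + (b a + 1) * -α₂ * |k₂| := by gcongr |p| + ?_ * |k₂|; exact (hb_lt a).le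
        _ = _ := by ring

/-- Margulis's Opposite Sign Lemma: if two affine transformations with linear
parts in SO(2,1) have Margulis invariants of opposite signs, the group they
generate does not act properly discontinuously on ℝ³. -/
theorem opposite_sign_lemma
    (G₁ G₂ : (Fin 3 → ℝ) ≃ₗ[ℝ] (Fin 3 → ℝ))
    (hO₁ : ∀ x y : Fin 3 → ℝ, minkowski (G₁ x) (G₁ y) = minkowski x y)
    (hO₂ : ∀ x y : Fin 3 → ℝ, minkowski (G₂ x) (G₂ y) = minkowski x y)
    (hdet₁ : LinearMap.det (G₁ : (Fin 3 → ℝ) →ₗ[ℝ] (Fin 3 → ℝ)) = 1)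
    (hdet₂ : LinearMap.det (G₂ : (Fin 3 → ℝ) →ₗ[ℝ] (Fin 3 → ℝ)) = 1)
    (v₁ v₂ : Fin 3 → ℝ)
    (hfix₁ : ∀ x : Fin 3 → ℝ, G₁ x = x ↔ ∃ c : ℝ, x = c • v₁)
    (hfix₂ : ∀ x : Fin 3 → ℝ, G₂ x = x ↔ ∃ c : ℝ, x = c • v₂)
    (hunit₁ : minkowski v₁ v₁ = 1)
    (hunit₂ : minkowski v₂ v₂ = 1)
    (hor₁ : ∀ v : Fin 3 → ℝ, minkowski v v < 0 →
      0 < Matrix.det (Matrix.transpose (Matrix.of ![v, G₁ (G₁ v), v₁])))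
    (hor₂ : ∀ v : Fin 3 → ℝ, minkowski v v < 0 →
      0 < Matrix.det (Matrix.transpose (Matrix.of ![v, G₂ (G₂ v), v₂])))
    (u₁ u₂ : Fin 3 → ℝ)
    (γ₁ γ₂ : (Fin 3 → ℝ) ≃ᵃ[ℝ] (Fin 3 → ℝ))
    (hγ₁ : ∀ x : Fin 3 → ℝ, γ₁ x = G₁ x + u₁)
    (hγ₂ : ∀ x : Fin 3 → ℝ, γ₂ x = G₂ x + u₂)
    (hsign₁ : 0 < minkowski u₁ v₁)
    (hsign₂ : minkowski u₂ v₂ < 0) :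
    ∃ K : Set (Fin 3 → ℝ), IsCompact K ∧
      {γ : (Fin 3 → ℝ) ≃ᵃ[ℝ] (Fin 3 → ℝ) |
        γ ∈ Subgroup.closure {γ₁, γ₂} ∧ (γ '' K ∩ K).Nonempty}.Infinite := by
  obtain ⟨e₁, f₁, c₁, μ₁, h₁⟩ := exists_isHyperbolicAffine_sq G₁ hO₁ v₁
    ((hfix₁ v₁).2 ⟨1, (one_smul ℝ v₁).symm⟩) hunit₁ hor₁ u₁ γ₁ hγ₁
  obtain ⟨e₂, f₂, c₂, μ₂, h₂⟩ := exists_isHyperbolicAffine_sq G₂ hO₂ v₂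
    ((hfix₂ v₂).2 ⟨1, (one_smul ℝ v₂).symm⟩) hunit₂ hor₂ u₂ γ₂ hγ₂
  have hα₁ : 0 < 2 * minkowski u₁ v₁ := by linarith
  have hα₂ : 2 * minkowski u₂ v₂ < 0 := by linarith
  have hm₁ : γ₁ ^ 2 ∈ Subgroup.closure {γ₁, γ₂} :=
    pow_mem (Subgroup.subset_closure (by simp)) 2
  have hm₂ : γ₂ ^ 2 ∈ Subgroup.closure {γ₁, γ₂} :=
    pow_mem (Subgroup.subset_closure (by simp)) 2
  by_cases hne : minkowski e₁ e₂ = 0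
  · exact h₁.inv.exists_isCompact_infinite h₂ (h₁.frame.minkowski_ne_zero h₂.frame hne) hα₁ hα₂ _
      (inv_mem hm₁) hm₂
  · exact h₁.exists_isCompact_infinite h₂ hne hα₁ hα₂ _ hm₁ hm₂
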